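/- Let γ be a finitely supported function ℕ × ℤ → ℚ and suppose γ = Σ_{k=1}^{ℓ} r_k·K(a^{(k)}) where each r_k is a strictly positive rational number and each a^{(k)} = (a_0^{(k)}, a_1^{(k)}, …, a_{c_k}^{(k)}) is a determining vector. Then for each k: (1) γ(0, a_0^{(k)}) ≠ 0; (2) γ(1, a_0^{(k)} + a_i^{(k)}) ≠ 0 for every 1 ≤ i ≤ c_k; (3) c_k ≤ pdim(γ); and (4) reg(K(a^{(k)})) ≤ reg(γ). -/

import Mathlib

/-- The Betti diagram of the complete intersection with determining vector
`(a0, a 0, …, a (c-1))`: the entry at `(i, d)` counts the subsets `S ⊆ {1,…,c}`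
with `|S| = i` and `a0 + Σ_{ℓ ∈ S} a ℓ = d`. -/
def bettiCI (c : ℕ) (a0 : ℤ) (a : Fin c → ℤ) : ℕ × ℤ → ℤ := fun p =>
  ((Finset.univ.filter fun S : Finset (Fin c) =>
      S.card = p.1 ∧ a0 + ∑ ℓ ∈ S, a ℓ = p.2).card : ℤ)

/-- The degrees part of a determining vector: entries are at least 1 and nondecreasing. -/
def IsDetVec {c : ℕ} (a : Fin c → ℤ) : Prop := (∀ j, 1 ≤ a j) ∧ Monotone a

/-- The projective dimension of a (rational-valued) diagram: the largest column
containing a nonzero entry. -/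
noncomputable def pdim (γ : ℕ × ℤ → ℚ) : ℕ := sSup {i | ∃ d, γ (i, d) ≠ 0}

/-- The regularity of a (rational-valued) diagram: the largest row `d - i`
containing a nonzero entry. -/
noncomputable def reg (γ : ℕ × ℤ → ℚ) : ℤ :=
  sSup {r | ∃ i d, γ (i, d) ≠ 0 ∧ r = d - (i : ℤ)}

/-- An entry of the diagram is nonzero exactly when some subset realizes it. -/
theorem bettiCI_ne_zero_iff {c : ℕ} {a0 : ℤ} {a : Fin c → ℤ} {p : ℕ × ℤ} :
    bettiCI c a0 a p ≠ 0 ↔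
      ∃ S : Finset (Fin c), S.card = p.1 ∧ a0 + ∑ ℓ ∈ S, a ℓ = p.2 := by
  simp [bettiCI, Finset.filter_eq_empty_iff]

theorem bettiCI_nonneg (c : ℕ) (a0 : ℤ) (a : Fin c → ℤ) (p : ℕ × ℤ) :
    0 ≤ bettiCI c a0 a p := by
  simp [bettiCI]

theorem finite_support_bettiCI (c : ℕ) (a0 : ℤ) (a : Fin c → ℤ) :
    (Function.support (bettiCI c a0 a)).Finite := by
  refine (Set.finite_range fun S : Finset (Fin c) => (S.card, a0 + ∑ ℓ ∈ S, a ℓ)).subset ?_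
  intro p hp
  obtain ⟨S, h₁, h₂⟩ := bettiCI_ne_zero_iff.1 hp
  exact ⟨S, Prod.ext h₁ h₂⟩

/-- A positive combination of nonnegative functions has the union of the supports as support. -/
theorem sum_mul_ne_zero_iff {ι : Type*} [Fintype ι] {r x : ι → ℚ}
    (hr : ∀ k, 0 < r k) (hx : ∀ k, 0 ≤ x k) :
    ∑ k, r k * x k ≠ 0 ↔ ∃ k, x k ≠ 0 := by
  rw [Ne, Finset.sum_eq_zero_iff_of_nonneg fun k _ => mul_nonneg (hr k).le (hx k)]
  simp [(hr _).ne']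

theorem le_pdim {γ : ℕ × ℤ → ℚ} (hγ : γ.support.Finite) {i : ℕ} {d : ℤ}
    (h : γ (i, d) ≠ 0) : i ≤ pdim γ := by
  refine le_csSup ((hγ.image Prod.fst).subset ?_).bddAbove ⟨d, h⟩
  rintro j ⟨e, he⟩
  exact ⟨(j, e), he, rfl⟩

theorem reg_mono {β γ : ℕ × ℤ → ℚ} (hγ : γ.support.Finite) (hβ : β.support.Nonempty)
    (h : β.support ⊆ γ.support) : reg β ≤ reg γ := by
  refine csSup_le_csSup ((hγ.image fun p => p.2 - (p.1 : ℤ)).subset ?_).bddAbove ?_ ?_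
  · rintro _ ⟨i, d, hid, rfl⟩
    exact ⟨(i, d), hid, rfl⟩
  · obtain ⟨⟨i, d⟩, hid⟩ := hβ
    exact ⟨_, i, d, hid, rfl⟩
  · rintro _ ⟨i, d, hid, rfl⟩
    exact ⟨i, d, h hid, rfl⟩

theorem stmt11 (γ : ℕ × ℤ → ℚ)
    (l : ℕ) (r : Fin l → ℚ) (hr : ∀ k, 0 < r k)
    (c : Fin l → ℕ) (hc : ∀ k, 1 ≤ c k)
    (a0 : Fin l → ℤ) (a : (k : Fin l) → Fin (c k) → ℤ)
    (ha : ∀ k, IsDetVec (a k))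
    (hγ : ∀ q : ℕ × ℤ, γ q = ∑ k, r k * (bettiCI (c k) (a0 k) (a k) q : ℚ)) :
    ∀ k, γ (0, a0 k) ≠ 0 ∧
      (∀ i : Fin (c k), γ (1, a0 k + a k i) ≠ 0) ∧
      c k ≤ pdim γ ∧
      reg (fun q => (bettiCI (c k) (a0 k) (a k) q : ℚ)) ≤ reg γ := by
  have hiff (q : ℕ × ℤ) : γ q ≠ 0 ↔ ∃ k, bettiCI (c k) (a0 k) (a k) q ≠ 0 := by
    rw [hγ, sum_mul_ne_zero_iff hr fun k => by exact_mod_cast bettiCI_nonneg _ _ _ _]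
    simp only [ne_eq, Int.cast_eq_zero]
  have hfin : γ.support.Finite := by
    refine (Set.finite_iUnion fun k => finite_support_bettiCI (c k) (a0 k) (a k)).subset ?_
    intro q hq
    simpa using (hiff q).1 hq
  have entry (k : Fin l) (S : Finset (Fin (c k))) :
      bettiCI (c k) (a0 k) (a k) (S.card, a0 k + ∑ ℓ ∈ S, a k ℓ) ≠ 0 :=
    bettiCI_ne_zero_iff.2 ⟨S, rfl, rfl⟩
  intro k
  have hne (S : Finset (Fin (c k))) : γ (S.card, a0 k + ∑ ℓ ∈ S, a k ℓ) ≠ 0 :=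
    (hiff _).2 ⟨k, entry k S⟩
  refine ⟨by simpa using hne ∅, fun i => by simpa using hne {i}, ?_, ?_⟩
  · simpa using le_pdim hfin (hne Finset.univ)
  · refine reg_mono hfin ⟨_, Int.cast_ne_zero.2 (entry k ∅)⟩ fun q hq => ?_
    exact (hiff q).2 ⟨k, Int.cast_ne_zero.1 hq⟩
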